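/- Let R be a commutative ring with identity and let a, b, c be elements of the Jacobson radical J(R) of R. Then the principal ideal Rabc is a weakly 1-absorbing prime ideal of R if and only if abc = 0. -/

import Mathlib

/-- A proper ideal `I` of a commutative ring `R` is *weakly 1-absorbing prime* if for all
nonunit elements `a, b, c` with `0 ≠ a * b * c ∈ I`, either `a * b ∈ I` or `c ∈ I`. -/
def IsWeakly1AbsorbingPrime {R : Type*} [CommRing R] (I : Ideal R) : Prop :=
  I ≠ ⊤ ∧ ∀ a b c : R, ¬IsUnit a → ¬IsUnit b → ¬IsUnit c →
    a * b * c ≠ 0 → a * b * c ∈ I → a * b ∈ I ∨ c ∈ I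

/-- A proper ideal `I` of a commutative ring `R` is *1-absorbing prime* if for all
nonunit elements `a, b, c` with `a * b * c ∈ I`, either `a * b ∈ I` or `c ∈ I`. -/
def Is1AbsorbingPrime {R : Type*} [CommRing R] (I : Ideal R) : Prop :=
  I ≠ ⊤ ∧ ∀ a b c : R, ¬IsUnit a → ¬IsUnit b → ¬IsUnit c →
    a * b * c ∈ I → a * b ∈ I ∨ c ∈ I

/-- A proper ideal `P` of a commutative ring `R` is *weakly prime* if for all `a, b`
with `0 ≠ a * b ∈ P`, either `a ∈ P` or `b ∈ P`. -/
def IsWeaklyPrime {R : Type*} [CommRing R] (P : Ideal R) : Prop :=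
  P ≠ ⊤ ∧ ∀ a b : R, a * b ≠ 0 → a * b ∈ P → a ∈ P ∨ b ∈ P

theorem not_isUnit_of_mem_jacobson_bot {R : Type*} [CommRing R] [Nontrivial R] {x : R}
    (hx : x ∈ (⊥ : Ideal R).jacobson) : ¬IsUnit x := by
  intro h
  obtain ⟨y, hy⟩ := h.exists_right_inv
  simpa [hy] using Ideal.mem_jacobson_bot.mp hx (-y)

theorem eq_zero_of_mem_span_mul_of_mem_jacobson_bot {R : Type*} [CommRing R] {x y : R}
    (hy : y ∈ (⊥ : Ideal R).jacobson) (h : x ∈ Ideal.span {x * y}) : x = 0 := by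
  obtain ⟨r, hr⟩ := Ideal.mem_span_singleton'.mp h
  refine (Ideal.mem_jacobson_bot.mp hy (-r)).mul_left_eq_zero.mp ?_
  linear_combination -hr

/-- For `a, b, c` in the Jacobson radical of `R`, the ideal `Rabc` is weakly 1-absorbing
prime iff `abc = 0`. -/
theorem statement16 {R : Type*} [CommRing R] [Nontrivial R] (a b c : R)
    (ha : a ∈ (⊥ : Ideal R).jacobson) (hb : b ∈ (⊥ : Ideal R).jacobson)
    (hc : c ∈ (⊥ : Ideal R).jacobson) :
    IsWeakly1AbsorbingPrime (Ideal.span {a * b * c}) ↔ a * b * c = 0 := by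
  constructor
  · rintro ⟨-, h⟩
    by_contra hne
    rcases h a b c (not_isUnit_of_mem_jacobson_bot ha) (not_isUnit_of_mem_jacobson_bot hb)
      (not_isUnit_of_mem_jacobson_bot hc) hne (Ideal.mem_span_singleton_self _) with h | h
    · exact hne (by rw [eq_zero_of_mem_span_mul_of_mem_jacobson_bot hc h, zero_mul])
    · have hab : a * b ∈ (⊥ : Ideal R).jacobson := Ideal.mul_mem_right b _ ha
      rw [mul_comm (a * b) c] at h
      exact hne (by rw [eq_zero_of_mem_span_mul_of_mem_jacobson_bot hab h, mul_zero])
  · intro h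
    rw [h, Ideal.span_singleton_zero]
    exact ⟨bot_ne_top, fun _ _ _ _ _ _ hne hmem => absurd (Ideal.mem_bot.mp hmem) hne⟩
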